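/- Let G be a finite simple graph containing an edge uv with d(u) + d(v) ≤ 10 such that u and v have at least one common neighbor (|N(u) ∩ N(v)| ≥ 1). Then there exists a set B of at most 8 edges of G such that γ_i(G − B) > γ_i(G); that is, b_i(G) ≤ 8. -/

import Mathlib

open scoped BigOperators

/-- A set of vertices is an independent dominating set: it is independent
(no two of its vertices are adjacent) and dominating (every vertex is in it
or adjacent to a vertex in it). -/
def SimpleGraph.IsIndepDomSet {V : Type*} (G : SimpleGraph V) (S : Set V) : Prop :=
  (∀ u ∈ S, ∀ w ∈ S, ¬ G.Adj u w) ∧ ∀ x, x ∈ S ∨ ∃ u ∈ S, G.Adj u x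

/-- The independent domination number: the minimum cardinality of an
independent dominating set. -/
noncomputable def SimpleGraph.indepDomNum {V : Type*} (G : SimpleGraph V) : ℕ :=
  sInf {n | ∃ S : Set V, G.IsIndepDomSet S ∧ S.ncard = n}

namespace SimpleGraph

variable {V : Type*} {G H : SimpleGraph V} {u v w : V}

theorem exists_isIndepDomSet [Finite V] (G : SimpleGraph V) : ∃ S : Set V, G.IsIndepDomSet S := by
  obtain ⟨S, hS⟩ := (Set.toFinite {S : Set V | ∀ a ∈ S, ∀ b ∈ S, ¬ G.Adj a b}).exists_maximal
    ⟨∅, by simp⟩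
  refine ⟨S, hS.prop, fun x => or_iff_not_imp_right.2 fun hx => ?_⟩
  push Not at hx
  refine hS.le_of_ge (y := insert x S) ?_ (Set.subset_insert x S) (Set.mem_insert x S)
  have := hS.prop
  rintro a (rfl | ha) b (rfl | hb)
  · exact G.irrefl
  · exact fun h => hx b hb h.symm
  · exact hx a ha
  · exact this a ha b hb

theorem indepDomNum_lt_of_forall_exists [Finite V]
    (h : ∀ S, H.IsIndepDomSet S → ∃ T, G.IsIndepDomSet T ∧ T.ncard < S.ncard) :
    G.indepDomNum < H.indepDomNum := by
  obtain ⟨S₀, hS₀⟩ := H.exists_isIndepDomSet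
  obtain ⟨S, hS, hcard⟩ := Nat.sInf_mem
    (s := {n | ∃ S : Set V, H.IsIndepDomSet S ∧ S.ncard = n}) ⟨S₀.ncard, S₀, hS₀, rfl⟩
  obtain ⟨T, hT, hlt⟩ := h S hS
  exact lt_of_le_of_lt (Nat.sInf_le ⟨T, hT, rfl⟩) (hlt.trans_eq hcard)

theorem isIndepDomSet_insert {T : Set V} {a : V}
    (hind : ∀ x ∈ T, ∀ y ∈ T, ¬ G.Adj x y) (ha : ∀ x ∈ T, ¬ G.Adj x a)
    (hdom : ∀ x, x = a ∨ G.Adj a x ∨ x ∈ T ∨ ∃ t ∈ T, G.Adj t x) :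
    G.IsIndepDomSet (insert a T) := by
  refine ⟨?_, fun x => ?_⟩
  · rintro x (rfl | hx) y (rfl | hy)
    · exact G.irrefl
    · exact fun h => ha y hy h.symm
    · exact ha x hx
    · exact hind x hx y hy
  · rcases hdom x with rfl | h | h | ⟨t, ht, h⟩
    · exact Or.inl (Set.mem_insert x T)
    · exact Or.inr ⟨a, Set.mem_insert a T, h⟩
    · exact Or.inl (Set.mem_insert_of_mem a h)
    · exact Or.inr ⟨t, Set.mem_insert_of_mem a ht, h⟩

/-- If `u`, `v`, `w` form a triangle of `G`, and `H` arises from `G` by deleting all edges at `u`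
or `v` except `uw`, then every independent dominating set of `H` can be beaten in `G`. -/
theorem exists_isIndepDomSet_ncard_lt [Finite V] (huv : G.Adj u v) (huw : G.Adj u w)
    (hvw : G.Adj v w)
    (hH : ∀ a b, a ≠ u → a ≠ v → b ≠ u → b ≠ v → (H.Adj a b ↔ G.Adj a b))
    (hu : ∀ x, H.Adj u x ↔ x = w) (hv : ∀ x, ¬ H.Adj v x) {S : Set V}
    (hS : H.IsIndepDomSet S) : ∃ T, G.IsIndepDomSet T ∧ T.ncard < S.ncard := by
  obtain ⟨hind, hdom⟩ := hS
  have hvS : v ∈ S := (hdom v).resolve_right fun ⟨x, _, hx⟩ => hv x hx.symm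
  by_cases hwS : w ∈ S
  · have huS : u ∉ S := fun h => hind u h w hwS ((hu w).2 rfl)
    refine ⟨S \ {v}, ⟨?_, fun x => ?_⟩, Set.ncard_sdiff_singleton_lt_of_mem hvS⟩
    · rintro a ⟨ha, hav⟩ b ⟨hb, hbv⟩ h
      exact hind a ha b hb ((hH a b (fun e => huS (e ▸ ha)) hav (fun e => huS (e ▸ hb)) hbv).2 h)
    · by_cases hxu : x = u
      · exact Or.inr ⟨w, ⟨hwS, hvw.ne'⟩, hxu ▸ huw.symm⟩
      by_cases hxv : x = v
      · exact Or.inr ⟨w, ⟨hwS, hvw.ne'⟩, hxv ▸ hvw.symm⟩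
      refine (hdom x).imp (fun h => ⟨h, hxv⟩) ?_
      rintro ⟨t, ht, htx⟩
      have htv : t ≠ v := fun e => hv x (e ▸ htx)
      exact ⟨t, ⟨ht, htv⟩, (hH t x (fun e => huS (e ▸ ht)) htv hxu hxv).1 htx⟩
  · have huS : u ∈ S := (hdom u).resolve_right fun ⟨x, hx, hxu⟩ =>
      hwS ((hu x).1 hxu.symm ▸ hx)
    set T := S \ {u, v}
    have hTcard : T.ncard + 2 = S.ncard := by
      rw [← Set.ncard_pair huv.ne]
      exact Set.ncard_sdiff_add_ncard_of_subset (by simp [Set.insert_subset_iff, huS, hvS])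
    have hT : ∀ t ∈ T, t ∈ S ∧ t ≠ u ∧ t ≠ v := fun t ht => by simpa [T] using ht
    have hTind : ∀ a ∈ T, ∀ b ∈ T, ¬ G.Adj a b := fun a ha b hb h => by
      obtain ⟨haS, hau, hav⟩ := hT a ha
      obtain ⟨hbS, hbu, hbv⟩ := hT b hb
      exact hind a haS b hbS ((hH a b hau hav hbu hbv).2 h)
    have hTdom : ∀ x, x = u ∨ x = v ∨ x = w ∨ x ∈ T ∨ ∃ t ∈ T, G.Adj t x := by
      refine fun x => or_iff_not_imp_left.2 fun hxu => or_iff_not_imp_left.2 fun hxv =>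
        or_iff_not_imp_left.2 fun hxw => (hdom x).imp (fun h => by simp [T, h, hxu, hxv]) ?_
      rintro ⟨t, ht, htx⟩
      have htv : t ≠ v := fun e => hv x (e ▸ htx)
      have htu : t ≠ u := fun e => hxw ((hu x).1 (e ▸ htx))
      exact ⟨t, by simp [T, ht, htu, htv], (hH t x htu htv hxu hxv).1 htx⟩
    have hlt : ∀ a, (insert a T).ncard < S.ncard := fun a => by
      have := Set.ncard_insert_le a T
      omega
    clear hH hind hdom hu hv hT
    clear_value T
    by_cases hTu : ∃ t ∈ T, G.Adj t u
    · by_cases hTv : ∃ t ∈ T, G.Adj t v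
      · by_cases hTw : ∃ t ∈ T, G.Adj t w
        · refine ⟨T, ⟨hTind, fun x => ?_⟩, by omega⟩
          grind [hTdom x]
        · refine ⟨_, isIndepDomSet_insert (a := w) hTind (by simpa using hTw) fun x => ?_, hlt w⟩
          grind [hTdom x]
      · refine ⟨_, isIndepDomSet_insert (a := v) hTind (by simpa using hTv) fun x => ?_, hlt v⟩
        grind [hTdom x, huv.symm]
    · refine ⟨_, isIndepDomSet_insert (a := u) hTind (by simpa using hTu) fun x => ?_, hlt u⟩
      grind [hTdom x]

end SimpleGraph

theorem stmt16 {V : Type*} [Fintype V]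
    (G : SimpleGraph V) (u v : V) (huv : G.Adj u v)
    (hdeg : (G.neighborSet u).ncard + (G.neighborSet v).ncard ≤ 10)
    (hcommon : 1 ≤ (G.neighborSet u ∩ G.neighborSet v).ncard) :
    ∃ B : Finset (Sym2 V), ↑B ⊆ G.edgeSet ∧ B.card ≤ 8 ∧
      G.indepDomNum < (G.deleteEdges ↑B).indepDomNum := by
  classical
  obtain ⟨w, huw, hvw⟩ := (Set.ncard_pos (Set.toFinite _)).1 hcommon
  rw [SimpleGraph.mem_neighborSet] at huw hvw
  set B : Set (Sym2 V) :=
    (fun x => s(u, x)) '' (G.neighborSet u \ {w}) ∪ (fun x => s(v, x)) '' (G.neighborSet v \ {u})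
    with hB
  have hmem : ∀ a b, s(a, b) ∈ B ↔ (∃ x, (G.Adj u x ∧ x ≠ w) ∧ s(u, x) = s(a, b)) ∨
      ∃ x, (G.Adj v x ∧ x ≠ u) ∧ s(v, x) = s(a, b) := fun a b => by
    simp [hB]
  refine ⟨B.toFinset, ?_, ?_, ?_⟩
  · rw [Set.coe_toFinset]
    rintro _ (⟨x, hx, rfl⟩ | ⟨x, hx, rfl⟩) <;> exact hx.1
  · rw [← Set.ncard_eq_toFinset_card', hB]
    have h₁ := Set.ncard_union_le ((fun x => s(u, x)) '' (G.neighborSet u \ {w}))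
      ((fun x => s(v, x)) '' (G.neighborSet v \ {u}))
    have h₂ := Set.ncard_image_le (f := fun x => s(u, x)) (Set.toFinite (G.neighborSet u \ {w}))
    have h₃ := Set.ncard_image_le (f := fun x => s(v, x)) (Set.toFinite (G.neighborSet v \ {u}))
    have h₄ := Set.ncard_sdiff_singleton_add_one (s := G.neighborSet u) (a := w) huw
    have h₅ := Set.ncard_sdiff_singleton_add_one (s := G.neighborSet v) (a := u) huv.symm
    omega
  · rw [Set.coe_toFinset]
    refine SimpleGraph.indepDomNum_lt_of_forall_exists fun S hS =>
      SimpleGraph.exists_isIndepDomSet_ncard_lt huv huw hvw ?_ ?_ ?_ hS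
    · intro a b _ _ _ _
      rw [SimpleGraph.deleteEdges_adj, hmem]
      grind
    · intro x
      rw [SimpleGraph.deleteEdges_adj, hmem]
      grind [huv.ne, huw.ne, hvw.ne]
    · intro x
      rw [SimpleGraph.deleteEdges_adj, hmem]
      grind [huv.ne, huw.ne, hvw.ne]
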